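/- Suppose A is Γ-graded D-simple. Then A[D] = ⊕_{α∈𝒥} A d^α, i.e. A[D] is the direct sum of the A-submodules A d^α over α ∈ 𝒥. -/

import Mathlib

/-- A skew-symmetric bicharacter `ε : Γ × Γ → F^×`. -/
def IsBichar {F : Type} [Field F] {Γ : Type} [AddCommGroup Γ] (ε : Γ → Γ → F) : Prop :=
  (∀ lam mu, ε lam mu * ε mu lam = 1) ∧
  (∀ lam mu nu, ε lam (mu + nu) = ε lam mu * ε lam nu)

variable (F : Type) [Field F] (Γ : Type) [AddCommGroup Γ] [DecidableEq Γ]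
  (A : Type) [Ring A] [Algebra F A]

/-- left multiplication operators -/
noncomputable def mulL : A →ₗ[F] Module.End F A := (Algebra.lmul F A).toLinearMap

variable {F Γ A}

/-- `f ∈ End_F(A)` is homogeneous of degree `δ`. -/
def IsHomogMap (𝒜 : Γ → Submodule F A) (δ : Γ) (f : Module.End F A) : Prop :=
  ∀ lam : Γ, ∀ a ∈ 𝒜 lam, f a ∈ 𝒜 (lam + δ)

/-- `f` is a homogeneous color-derivation of degree `δ`. -/
def IsColorDer (𝒜 : Γ → Submodule F A) (ε : Γ → Γ → F) (δ : Γ) (f : Module.End F A) : Prop :=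
  IsHomogMap 𝒜 δ f ∧
  ∀ lam : Γ, ∀ a ∈ 𝒜 lam, ∀ b : A, f (a * b) = f a * b + ε δ lam • (a * f b)

/-- `Der^ε(A)`: the F-span of homogeneous color derivations. -/
def DerE (𝒜 : Γ → Submodule F A) (ε : Γ → Γ → F) : Submodule F (Module.End F A) :=
  Submodule.span F {f | ∃ δ, IsColorDer 𝒜 ε δ f}

/-- `A` is ε-commutative. -/
def IsColorComm (𝒜 : Γ → Submodule F A) (ε : Γ → Γ → F) : Prop :=
  ∀ lam mu : Γ, ∀ a ∈ 𝒜 lam, ∀ b ∈ 𝒜 mu, a * b = ε lam mu • (b * a)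

/-- `D` is color-commutative. -/
def DColorComm (𝒜 : Γ → Submodule F A) (ε : Γ → Γ → F) (D : Submodule F (Module.End F A)) : Prop :=
  ∀ δ δ' f g, f ∈ D → g ∈ D → IsColorDer 𝒜 ε δ f → IsColorDer 𝒜 ε δ' g →
    f * g = ε δ δ' • (g * f)

/-- `D` is a Γ-graded subspace: it is spanned by its homogeneous color-derivations. -/
def DGraded (𝒜 : Γ → Submodule F A) (ε : Γ → Γ → F) (D : Submodule F (Module.End F A)) : Prop :=
  D = Submodule.span F {f | f ∈ D ∧ ∃ δ, IsColorDer 𝒜 ε δ f}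

/-- `A[D]`: the unital subalgebra of `End_F(A)` generated by left multiplications and `D`. -/
noncomputable def AD (D : Submodule F (Module.End F A)) : Subalgebra F (Module.End F A) :=
  Algebra.adjoin F (Set.range (mulL F A) ∪ (D : Set (Module.End F A)))

/-- `A` is Γ-graded `D`-simple. -/
def GradedDSimple (𝒜 : Γ → Submodule F A) [GradedAlgebra 𝒜] (D : Submodule F (Module.End F A)) :
    Prop :=
  ∀ I : Ideal A, Ideal.IsHomogeneous 𝒜 I → (∀ f ∈ D, ∀ x ∈ I, f x ∈ I) → I = ⊥ ∨ I = ⊤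

/-- F₁ = A^D -/
def F1 (D : Submodule F (Module.End F A)) : Submodule F A where
  carrier := {u | ∀ f ∈ D, f u = 0}
  add_mem' := by
    intro a b ha hb f hf
    rw [map_add, ha f hf, hb f hf, add_zero]
  zero_mem' := by intro f hf; exact map_zero f
  smul_mem' := by
    intro c x hx f hf
    rw [map_smul, hx f hf, smul_zero]

/-- the derived space `W = [A[D], A[D]]`. -/
def Wsub (𝒜 : Γ → Submodule F A) (ε : Γ → Γ → F) (D : Submodule F (Module.End F A)) :
    Submodule F (Module.End F A) :=
  Submodule.span F {w | ∃ γ γ' x y, x ∈ AD D ∧ y ∈ AD D ∧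
    IsHomogMap 𝒜 γ x ∧ IsHomogMap 𝒜 γ' y ∧ w = x * y - ε γ γ' • (y * x)}

/-- `F₁[D]`. -/
noncomputable def F1D (D : Submodule F (Module.End F A)) : Subalgebra F (Module.End F A) :=
  Algebra.adjoin F ((mulL F A '' (F1 D : Set A)) ∪ (D : Set (Module.End F A)))

/-- `𝒟 = Der^ε(A) ∩ F₁[D]`. -/
def DScr (𝒜 : Γ → Submodule F A) (ε : Γ → Γ → F) (D : Submodule F (Module.End F A)) :
    Set (Module.End F A) :=
  {f | f ∈ F1D D ∧ f ∈ DerE 𝒜 ε}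

variable {I : Type} [LinearOrder I]

/-- ordered product `d^α`. -/
noncomputable def dpow (d : I → Module.End F A) (α : I →₀ ℕ) : Module.End F A :=
  ((α.support.sort (· ≤ ·)).map fun i => d i ^ α i).prod

/-- membership in the index set 𝒥. -/
def inJ (ε : Γ → Γ → F) (δd : I → Γ) (α : I →₀ ℕ) : Prop :=
  (∀ i, ringChar F ≠ 0 → α i ≤ ringChar F - 1) ∧
  (∀ i, ε (δd i) (δd i) = -1 → α i ≤ 1)

/-- the degree of `d^α`. -/
def degJ (δd : I → Γ) (α : I →₀ ℕ) : Γ := α.sum fun i n => n • δd i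

/-- the subalgebra `S` of `End_F(A)` is Γ-graded simple. -/
def GradedSimpleAlgOn (𝒜 : Γ → Submodule F A) (S : Subalgebra F (Module.End F A)) : Prop :=
  ∀ L : Submodule F (Module.End F A),
    L ≤ Subalgebra.toSubmodule S →
    (∀ x ∈ S, ∀ y ∈ L, x * y ∈ L ∧ y * x ∈ L) →
    L = Submodule.span F {f | f ∈ L ∧ ∃ δ, IsHomogMap 𝒜 δ f} →
    (L = ⊥ ∨ L = Subalgebra.toSubmodule S)

/-- variant of 𝒥 without characteristic restriction -/
def inJ0 (ε : Γ → Γ → F) (δd : I → Γ) (α : I →₀ ℕ) : Prop :=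
  ∀ i, ε (δd i) (δd i) = -1 → α i ≤ 1

/-- the sum `Σ_{α ∈ J0} B d^α` is direct -/
def DirectOn (d : I → Module.End F A) (J0 : Set (I →₀ ℕ)) (Bs : Set A) : Prop :=
  ∀ (s : Finset (I →₀ ℕ)) (c : (I →₀ ℕ) → A), ↑s ⊆ J0 → (∀ α ∈ s, c α ∈ Bs) →
    (∑ α ∈ s, mulL F A (c α) * dpow d α) = 0 → ∀ α ∈ s, mulL F A (c α) * dpow d α = 0

/-- span of color brackets of homogeneous elements of `M` and `N` -/
def brkE (𝒜 : Γ → Submodule F A) (ε : Γ → Γ → F) (M N : Submodule F (Module.End F A)) :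
    Submodule F (Module.End F A) :=
  Submodule.span F {w | ∃ γ γ' x y, x ∈ M ∧ y ∈ N ∧
    IsHomogMap 𝒜 γ x ∧ IsHomogMap 𝒜 γ' y ∧ w = x * y - ε γ γ' • (y * x)}

set_option linter.unusedSectionVars false

section Bicharacter

theorem IsBichar.ne_zero {ε : Γ → Γ → F} (h : IsBichar ε) (a b : Γ) : ε a b ≠ 0 :=
  left_ne_zero_of_mul_eq_one (h.1 a b)

theorem IsBichar.inv_eq {ε : Γ → Γ → F} (h : IsBichar ε) (a b : Γ) : (ε a b)⁻¹ = ε b a :=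
  inv_eq_of_mul_eq_one_right (h.1 a b)

theorem IsBichar.add_left {ε : Γ → Γ → F} (h : IsBichar ε) (a b c : Γ) :
    ε (a + b) c = ε a c * ε b c := by
  rw [← h.inv_eq c (a + b), h.2, mul_inv, h.inv_eq, h.inv_eq]

theorem IsBichar.zero_right {ε : Γ → Γ → F} (h : IsBichar ε) (a : Γ) : ε a 0 = 1 := by
  have h0 := h.2 a 0 0
  rw [add_zero] at h0
  exact mul_left_cancel₀ (h.ne_zero a 0) (by rw [← h0, mul_one])

theorem IsBichar.zero_left {ε : Γ → Γ → F} (h : IsBichar ε) (a : Γ) : ε 0 a = 1 := by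
  rw [← h.inv_eq a 0, h.zero_right, inv_one]

theorem IsBichar.nsmul_left {ε : Γ → Γ → F} (h : IsBichar ε) (a b : Γ) (n : ℕ) :
    ε (n • a) b = ε a b ^ n := by
  induction n with
  | zero => rw [zero_smul, h.zero_left, pow_zero]
  | succ n ih => rw [succ_nsmul, h.add_left, ih, pow_succ]

theorem IsBichar.self_eq {ε : Γ → Γ → F} (h : IsBichar ε) (a : Γ) :
    ε a a = 1 ∨ ε a a = -1 :=
  mul_self_eq_one_iff.1 (h.1 a a)

end Bicharacter

section HomogeneousMaps

theorem mulL_mul_eq_smul (a : A) (f : Module.End F A) : mulL F A a * f = a • f :=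
  rfl

theorem IsHomogMap.mul {𝒜 : Γ → Submodule F A} {δ δ' : Γ} {f g : Module.End F A}
    (hf : IsHomogMap 𝒜 δ f) (hg : IsHomogMap 𝒜 δ' g) : IsHomogMap 𝒜 (δ + δ') (f * g) := by
  intro lam a ha
  rw [add_comm δ, ← add_assoc]
  exact hf _ _ (hg _ _ ha)

theorem IsHomogMap.one (𝒜 : Γ → Submodule F A) : IsHomogMap 𝒜 0 1 := by
  intro lam a ha
  rwa [add_zero]

theorem IsHomogMap.smul {𝒜 : Γ → Submodule F A} {δ : Γ} {f : Module.End F A}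
    (hf : IsHomogMap 𝒜 δ f) (c : F) : IsHomogMap 𝒜 δ (c • f) :=
  fun lam a ha => Submodule.smul_mem _ c (hf lam a ha)

theorem IsHomogMap.pow {𝒜 : Γ → Submodule F A} {δ : Γ} {f : Module.End F A}
    (hf : IsHomogMap 𝒜 δ f) (n : ℕ) : IsHomogMap 𝒜 (n • δ) (f ^ n) := by
  induction n with
  | zero => simpa using IsHomogMap.one 𝒜
  | succ n ih => rw [succ_nsmul, pow_succ]; exact ih.mul hf

variable (𝒜 : Γ → Submodule F A) [GradedAlgebra 𝒜]

theorem isHomogMap_mulL {lam : Γ} {a : A} (ha : a ∈ 𝒜 lam) : IsHomogMap 𝒜 lam (mulL F A a) := by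
  intro mu b hb
  rw [add_comm]
  exact SetLike.mul_mem_graded ha hb

theorem end_ext_of_homogeneous {f g : Module.End F A}
    (h : ∀ lam, ∀ a ∈ 𝒜 lam, f a = g a) : f = g := by
  ext a
  induction a using DirectSum.Decomposition.inductionOn 𝒜 with
  | zero => simp
  | homogeneous m => exact h _ _ m.2
  | add m n hm hn => rw [map_add, map_add, hm, hn]

/-- The operator acting on each `𝒜 lam` as multiplication by the scalar `θ lam`. -/
noncomputable def diagOp (θ : Γ → F) : Module.End F A :=
  DirectSum.coeLinearMap 𝒜 ∘ₗ DirectSum.lmap (fun lam => θ lam • LinearMap.id) ∘ₗ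
    (DirectSum.decomposeLinearEquiv 𝒜).toLinearMap

theorem diagOp_apply (θ : Γ → F) {lam : Γ} {a : A} (ha : a ∈ 𝒜 lam) :
    diagOp 𝒜 θ a = θ lam • a := by
  lift a to 𝒜 lam using ha
  simp [diagOp]

theorem diagOp_mul_diagOp_inv {θ : Γ → F} (hθ : ∀ lam, θ lam ≠ 0) :
    diagOp 𝒜 θ * diagOp 𝒜 (fun lam => (θ lam)⁻¹) = 1 := by
  refine end_ext_of_homogeneous 𝒜 fun lam a ha => ?_
  rw [Module.End.mul_apply, diagOp_apply 𝒜 _ ha, map_smul, diagOp_apply 𝒜 _ ha, smul_smul,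
    inv_mul_cancel₀ (hθ lam), one_smul, Module.End.one_apply]

theorem diagOp_inv_mul_diagOp {θ : Γ → F} (hθ : ∀ lam, θ lam ≠ 0) :
    diagOp 𝒜 (fun lam => (θ lam)⁻¹) * diagOp 𝒜 θ = 1 := by
  refine end_ext_of_homogeneous 𝒜 fun lam a ha => ?_
  rw [Module.End.mul_apply, diagOp_apply 𝒜 _ ha, map_smul, diagOp_apply 𝒜 _ ha, smul_smul,
    mul_inv_cancel₀ (hθ lam), one_smul, Module.End.one_apply]

theorem diagOp_conj {θ : Γ → F} (hθ : ∀ lam, θ lam ≠ 0)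
    (hadd : ∀ lam mu, θ (lam + mu) = θ lam * θ mu) {δ : Γ} {f : Module.End F A}
    (hf : IsHomogMap 𝒜 δ f) :
    diagOp 𝒜 θ * f * diagOp 𝒜 (fun lam => (θ lam)⁻¹) = θ δ • f := by
  refine end_ext_of_homogeneous 𝒜 fun lam a ha => ?_
  rw [Module.End.mul_apply, Module.End.mul_apply, diagOp_apply 𝒜 _ ha, map_smul, map_smul,
    diagOp_apply 𝒜 _ (hf lam a ha), smul_smul, hadd, ← mul_assoc, inv_mul_cancel₀ (hθ lam),
    one_mul, LinearMap.smul_apply]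

theorem IsHomogMap.proj_apply {δ : Γ} {f : Module.End F A} (hf : IsHomogMap 𝒜 δ f) (lam : Γ)
    (a : A) : GradedAlgebra.proj 𝒜 (lam + δ) (f a) = f (GradedAlgebra.proj 𝒜 lam a) := by
  induction a using DirectSum.Decomposition.inductionOn 𝒜 with
  | zero => simp
  | @homogeneous mu m =>
    simp only [GradedAlgebra.proj_apply]
    by_cases h : mu = lam
    · subst h
      rw [DirectSum.decompose_of_mem_same _ (hf _ _ m.2), DirectSum.decompose_of_mem_same _ m.2]
    · rw [DirectSum.decompose_of_mem_ne _ (hf _ _ m.2) (by simpa using h),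
        DirectSum.decompose_of_mem_ne _ m.2 h, map_zero]
  | add m n hm hn => simp only [map_add, hm, hn]

theorem sum_proj_eq (a : A) : ∃ s : Finset Γ, ∑ lam ∈ s, GradedAlgebra.proj 𝒜 lam a = a := by
  classical
  exact ⟨_, DirectSum.sum_support_decompose 𝒜 a⟩

theorem proj_mem (lam : Γ) (a : A) : GradedAlgebra.proj 𝒜 lam a ∈ 𝒜 lam := by
  rw [GradedAlgebra.proj_apply]
  exact SetLike.coe_mem _

theorem proj_of_mem {lam : Γ} {a : A} (ha : a ∈ 𝒜 lam) : GradedAlgebra.proj 𝒜 lam a = a := by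
  rw [GradedAlgebra.proj_apply, DirectSum.decompose_of_mem_same _ ha]

end HomogeneousMaps

section Commutation

variable {𝒜 : Γ → Submodule F A} [GradedAlgebra 𝒜] {ε : Γ → Γ → F}
  {D : Submodule F (Module.End F A)}

theorem IsColorDer.mul_mulL {δ : Γ} {f : Module.End F A} (hf : IsColorDer 𝒜 ε δ f) {lam : Γ}
    {a : A} (ha : a ∈ 𝒜 lam) :
    f * mulL F A a = mulL F A (f a) + ε δ lam • (mulL F A a * f) := by
  ext b
  exact hf.2 lam a ha b

theorem IsColorDer.mul_smul {δ : Γ} {f : Module.End F A} (hf : IsColorDer 𝒜 ε δ f) {lam : Γ}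
    {a : A} (ha : a ∈ 𝒜 lam) (g : Module.End F A) :
    f * a • g = f a • g + ε δ lam • a • (f * g) := by
  ext b
  exact hf.2 lam a ha (g b)

theorem proj_mem_F1 (hDgr : DGraded 𝒜 ε D) {u : A} (hu : u ∈ F1 D) (lam : Γ) :
    GradedAlgebra.proj 𝒜 lam u ∈ F1 D := by
  intro f hf
  rw [hDgr] at hf
  induction hf using Submodule.span_induction with
  | mem f hf =>
    obtain ⟨hfD, δ, hδ⟩ := hf
    rw [← hδ.1.proj_apply, hu f hfD, map_zero]
  | zero => rfl
  | add f g _ _ hf hg => rw [LinearMap.add_apply, hf, hg, add_zero]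
  | smul c f _ hf => rw [LinearMap.smul_apply, hf, smul_zero]

/-- A homogeneous operator that color-commutes with the homogeneous generators of `F₁[D]`
color-commutes with every homogeneous element of `F₁[D]`. -/
theorem color_comm_of_generators (hbich : IsBichar ε) (hDgr : DGraded 𝒜 ε D) {γ : Γ}
    {g : Module.End F A}
    (hF1 : ∀ lam, ∀ u ∈ 𝒜 lam, u ∈ F1 D → mulL F A u * g = ε lam γ • (g * mulL F A u))
    (hD : ∀ δ, ∀ f ∈ D, IsColorDer 𝒜 ε δ f → f * g = ε δ γ • (g * f))
    {x : Module.End F A} (hx : x ∈ F1D D) {δ : Γ} (hxδ : IsHomogMap 𝒜 δ x) :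
    x * g = ε δ γ • (g * x) := by
  set θ : Γ → F := fun lam => ε lam γ
  have hθ : ∀ lam, θ lam ≠ 0 := fun lam => hbich.ne_zero lam γ
  have hadd : ∀ lam mu, θ (lam + mu) = θ lam * θ mu := fun lam mu => hbich.add_left lam mu γ
  set S := diagOp 𝒜 θ
  set S' := diagOp 𝒜 (fun lam => (θ lam)⁻¹)
  have hSS' : S * S' = 1 := diagOp_mul_diagOp_inv 𝒜 hθ
  have hS'S : S' * S = 1 := diagOp_inv_mul_diagOp 𝒜 hθ
  have key : x * g = g * (S * x * S') := by
    clear hxδ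
    induction hx using Algebra.adjoin_induction with
    | mem x hx =>
      rcases hx with ⟨u, hu, rfl⟩ | hx
      · obtain ⟨s, hs⟩ := sum_proj_eq 𝒜 u
        rw [← hs]
        simp only [map_sum, Finset.sum_mul, Finset.mul_sum]
        refine Finset.sum_congr rfl fun lam _ => ?_
        rw [hF1 lam _ (proj_mem 𝒜 lam u) (proj_mem_F1 hDgr hu lam),
          diagOp_conj 𝒜 hθ hadd (isHomogMap_mulL 𝒜 (proj_mem 𝒜 lam u)), mul_smul_comm]
      · change x ∈ D at hx
        rw [hDgr] at hx
        induction hx using Submodule.span_induction with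
        | mem f hf =>
          obtain ⟨hfD, δ, hδ⟩ := hf
          rw [hD δ f hfD hδ, diagOp_conj 𝒜 hθ hadd hδ.1, mul_smul_comm]
        | zero => simp
        | add f h _ _ hf hh => simp only [add_mul, mul_add, hf, hh]
        | smul c f _ hf => simp only [smul_mul_assoc, mul_smul_comm, hf]
    | algebraMap r =>
      rw [← Algebra.commutes r S, mul_assoc, hSS', mul_one, Algebra.commutes]
    | add x y _ _ hx hy => simp only [add_mul, mul_add, hx, hy]
    | mul x y _ _ hx hy =>
      calc x * y * g = x * g * (S * y * S') := by rw [mul_assoc, hy, ← mul_assoc]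
        _ = g * (S * x * (S' * S) * y * S') := by rw [hx]; simp only [mul_assoc]
        _ = g * (S * (x * y) * S') := by rw [hS'S, mul_one]; simp only [mul_assoc]
  rw [key, diagOp_conj 𝒜 hθ hadd hxδ, mul_smul_comm]

theorem mulL_F1_comm_derivation (hbich : IsBichar ε) {δ lam : Γ} {f : Module.End F A} {u : A}
    (hf : IsColorDer 𝒜 ε δ f) (hfD : f ∈ D) (hu : u ∈ 𝒜 lam) (huF : u ∈ F1 D) :
    mulL F A u * f = ε lam δ • (f * mulL F A u) := by
  rw [hf.mul_mulL hu, huF f hfD, map_zero, zero_add, smul_smul, hbich.1, one_smul]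

/-- Homogeneous elements of `F₁[D]` color-commute. -/
theorem F1D_color_comm (hbich : IsBichar ε) (hcomm : IsColorComm 𝒜 ε) (hDgr : DGraded 𝒜 ε D)
    (hDcc : DColorComm 𝒜 ε D) {x y : Module.End F A} (hx : x ∈ F1D D) (hy : y ∈ F1D D)
    {δ δ' : Γ} (hxδ : IsHomogMap 𝒜 δ x) (hyδ : IsHomogMap 𝒜 δ' y) :
    x * y = ε δ δ' • (y * x) := by
  have swap : ∀ {α β : Γ} {f g : Module.End F A}, f * g = ε α β • (g * f) →
      g * f = ε β α • (f * g) := by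
    intro α β f g h
    rw [h, smul_smul, hbich.1, one_smul]
  have hgen : ∀ γ, ∀ g : Module.End F A,
      (∀ lam, ∀ u ∈ 𝒜 lam, u ∈ F1 D → mulL F A u * g = ε lam γ • (g * mulL F A u)) →
      (∀ δ, ∀ f ∈ D, IsColorDer 𝒜 ε δ f → f * g = ε δ γ • (g * f)) →
      g * y = ε γ δ' • (y * g) := fun γ g h₁ h₂ =>
    swap (color_comm_of_generators hbich hDgr h₁ h₂ hy hyδ)
  refine color_comm_of_generators hbich hDgr ?_ ?_ hx hxδ
  · intro lam u hu huF
    refine hgen lam _ ?_ ?_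
    · intro mu v hv _
      rw [mulL, AlgHom.toLinearMap_apply, AlgHom.toLinearMap_apply, ← map_mul, ← map_mul,
        hcomm mu lam v hv u hu, map_smul]
    · intro δ f hfD hf
      exact swap (mulL_F1_comm_derivation hbich hf hfD hu huF)
  · intro δ f hfD hf
    refine hgen δ f ?_ ?_
    · intro lam u hu huF
      exact mulL_F1_comm_derivation hbich hf hfD hu huF
    · intro δ₁ f₁ hf₁D hf₁
      exact hDcc δ₁ δ f₁ f hf₁D hfD hf₁ hf

end Commutation

section OrderedProducts

/-- Every multi-index is obtained from `0` by successively raising single exponents. -/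
theorem multiIndex_induction {P : (I →₀ ℕ) → Prop} (zero : P 0)
    (add_single : ∀ α i, P α → P (α + Finsupp.single i 1)) (α : I →₀ ℕ) : P α := by
  induction α using Finsupp.induction with
  | zero => exact zero
  | single_add a b f _ _ hf =>
    clear * - hf add_single
    induction b with
    | zero => simpa using hf
    | succ b ih =>
      have h := add_single _ a ih
      rwa [add_right_comm, ← Finsupp.single_add] at h

theorem exists_eq_add_single {α : I →₀ ℕ} {i : I} {n : ℕ} (h : n ≤ α i) :
    ∃ β, α = β + Finsupp.single i n :=
  ⟨α - Finsupp.single i n, (tsub_add_cancel_of_le (Finsupp.single_le_iff.2 h)).symm⟩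

theorem degJ_add (δd : I → Γ) (α β : I →₀ ℕ) : degJ δd (α + β) = degJ δd α + degJ δd β :=
  Finsupp.sum_add_index' (fun _ => zero_smul _ _) fun _ _ _ => add_smul _ _ _

theorem degJ_single_one (δd : I → Γ) (i : I) : degJ δd (Finsupp.single i 1) = δd i := by
  simp [degJ]

theorem degJ_zero (δd : I → Γ) : degJ δd 0 = 0 :=
  Finsupp.sum_zero_index

/-- The scalar relating `d i * d^γ` to `d^(γ + single i 1)`. -/
noncomputable def swapSign (ε : Γ → Γ → F) (δd : I → Γ) (i : I) (γ : I →₀ ℕ) : F :=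
  γ.prod fun j m => if j < i then ε (δd i) (δd j) ^ m else 1

theorem swapSign_add (ε : Γ → Γ → F) (δd : I → Γ) (i : I) (α β : I →₀ ℕ) :
    swapSign ε δd i (α + β) = swapSign ε δd i α * swapSign ε δd i β := by
  refine Finsupp.prod_add_index' (fun _ => by simp) fun j m n => ?_
  split_ifs
  · exact pow_add _ _ _
  · exact (one_mul 1).symm

theorem swapSign_single (ε : Γ → Γ → F) (δd : I → Γ) (i j : I) (m : ℕ) :
    swapSign ε δd i (Finsupp.single j m) = if j < i then ε (δd i) (δd j) ^ m else 1 :=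
  Finsupp.prod_single_index (by simp)

theorem swapSign_ne_zero {ε : Γ → Γ → F} (hbich : IsBichar ε) (δd : I → Γ) (i : I)
    (γ : I →₀ ℕ) : swapSign ε δd i γ ≠ 0 := by
  refine Finset.prod_ne_zero_iff.2 fun j _ => ?_
  dsimp only
  split_ifs
  · exact pow_ne_zero _ (hbich.ne_zero _ _)
  · exact one_ne_zero

theorem dpow_zero (d : I → Module.End F A) : dpow d 0 = 1 := by
  simp [dpow]

theorem dpow_single_add (d : I → Module.End F A) (a : I) (b : ℕ) (f : I →₀ ℕ)
    (h : ∀ c ∈ f.support, a < c) : dpow d (Finsupp.single a b + f) = d a ^ b * dpow d f := by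
  rcases eq_or_ne b 0 with rfl | hb
  · simp
  have ha : a ∉ f.support := fun h' => lt_irrefl _ (h a h')
  have hfa : f a = 0 := Finsupp.notMem_support_iff.1 ha
  have hs : (Finsupp.single a b + f).support = insert a f.support := by
    ext c
    by_cases hc : c = a
    · simp [hc, hb]
    · simp [hc, Finsupp.single_eq_of_ne hc]
  rw [dpow, hs, Finset.sort_insert _ (fun c hc => (h c hc).le) ha, List.map_cons, List.prod_cons,
    dpow]
  congr 1
  · simp [hfa]
  · refine congrArg List.prod (List.map_congr_left fun c hc => ?_)
    have hca : a ≠ c := (h c ((Finset.mem_sort _).1 hc)).ne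
    simp [Finsupp.single_eq_of_ne' hca]

variable {𝒜 : Γ → Submodule F A} {ε : Γ → Γ → F} {d : I → Module.End F A} {δd : I → Γ}

theorem mul_pow_color {x y : Module.End F A} {e : F} (h : x * y = e • (y * x)) (n : ℕ) :
    x * y ^ n = e ^ n • (y ^ n * x) := by
  induction n with
  | zero => simp
  | succ n ih =>
    rw [pow_succ, ← mul_assoc, ih, smul_mul_assoc, mul_assoc, h, mul_smul_comm, smul_smul,
      pow_succ, mul_assoc]

theorem d_mul_dpow (hdcc : ∀ i j, d i * d j = ε (δd i) (δd j) • (d j * d i)) (i : I)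
    (γ : I →₀ ℕ) :
    d i * dpow d γ = swapSign ε δd i γ • dpow d (γ + Finsupp.single i 1) := by
  induction γ using Finsupp.induction_on_min with
  | zero =>
    have h := dpow_single_add d i 1 0 (by simp)
    rw [pow_one, add_zero] at h
    simp [swapSign, h]
  | single_add a b f hf hb ih =>
    rw [swapSign_add, swapSign_single]
    rcases lt_trichotomy i a with h | rfl | h
    · have hlt : ∀ c ∈ f.support, ¬ c < i := fun c hc => (h.trans (hf c hc)).not_gt
      have hsign : swapSign ε δd i f = 1 := Finset.prod_eq_one fun c hc => if_neg (hlt c hc)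
      rw [if_neg h.not_gt, hsign, one_mul, one_smul, add_comm _ (Finsupp.single i 1),
        dpow_single_add d i 1, pow_one]
      intro c hc
      rcases Finset.mem_union.1 (Finsupp.support_add hc) with hc | hc
      · rwa [Finset.mem_singleton.1 (Finsupp.support_single_subset hc)]
      · exact h.trans (hf c hc)
    · have hsign : swapSign ε δd i f = 1 :=
        Finset.prod_eq_one fun c hc => if_neg (hf c hc).not_gt
      rw [if_neg (lt_irrefl _), hsign, one_mul, one_smul, add_right_comm, ← Finsupp.single_add,
        dpow_single_add d i _ f hf, dpow_single_add d i _ f hf, pow_succ', mul_assoc]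
    · have hf' : ∀ c ∈ (f + Finsupp.single i 1).support, a < c := by
        intro c hc
        rcases Finset.mem_union.1 (Finsupp.support_add hc) with hc | hc
        · exact hf c hc
        · rwa [Finset.mem_singleton.1 (Finsupp.support_single_subset hc)]
      rw [if_pos h, dpow_single_add d a b f hf, ← mul_assoc, mul_pow_color (hdcc i a),
        smul_mul_assoc, mul_assoc, ih, mul_smul_comm, smul_smul, add_assoc,
        dpow_single_add d a b _ hf']

theorem dpow_add_single (hbich : IsBichar ε)
    (hdcc : ∀ i j, d i * d j = ε (δd i) (δd j) • (d j * d i)) (i : I) (γ : I →₀ ℕ) :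
    dpow d (γ + Finsupp.single i 1) = (swapSign ε δd i γ)⁻¹ • (d i * dpow d γ) := by
  rw [d_mul_dpow hdcc, smul_smul, inv_mul_cancel₀ (swapSign_ne_zero hbich δd i γ), one_smul]

theorem d_pow_mul_dpow (hbich : IsBichar ε)
    (hdcc : ∀ i j, d i * d j = ε (δd i) (δd j) • (d j * d i)) (i : I) (γ : I →₀ ℕ) (n : ℕ) :
    ∃ c : F, dpow d (γ + Finsupp.single i n) = c • (d i ^ n * dpow d γ) := by
  induction n with
  | zero => exact ⟨1, by simp⟩
  | succ n ih =>
    obtain ⟨c, hc⟩ := ih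
    exact ⟨(swapSign ε δd i (γ + Finsupp.single i n))⁻¹ * c, by
      rw [Finsupp.single_add, ← add_assoc, dpow_add_single hbich hdcc, hc, mul_smul_comm,
        smul_smul, pow_succ', mul_assoc]⟩

theorem isHomogMap_dpow (hbich : IsBichar ε)
    (hdcc : ∀ i j, d i * d j = ε (δd i) (δd j) • (d j * d i))
    (hd : ∀ i, IsHomogMap 𝒜 (δd i) (d i)) (α : I →₀ ℕ) :
    IsHomogMap 𝒜 (degJ δd α) (dpow d α) := by
  induction α using multiIndex_induction with
  | zero => rw [degJ_zero, dpow_zero]; exact IsHomogMap.one 𝒜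
  | add_single α i ih =>
    rw [degJ_add, degJ_single_one, dpow_add_single hbich hdcc, add_comm]
    exact ((hd i).mul ih).smul _

theorem dpow_mem {S : Subalgebra F (Module.End F A)} (hd : ∀ i, d i ∈ S) (α : I →₀ ℕ) :
    dpow d α ∈ S := by
  refine S.toSubmonoid.list_prod_mem fun x hx => ?_
  obtain ⟨i, _, rfl⟩ := List.mem_map.1 hx
  exact S.pow_mem (hd i) _

end OrderedProducts

section Filtration

variable {𝒜 : Γ → Submodule F A} [GradedAlgebra 𝒜] {ε : Γ → Γ → F}
  {d : I → Module.End F A} {δd : I → Γ}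

/-- The left `A`-span of the `d^α` with `|α| < k`. -/
noncomputable def lowSpan (d : I → Module.End F A) (k : ℕ) : Submodule A (Module.End F A) :=
  Submodule.span A {x | ∃ α : I →₀ ℕ, α.degree < k ∧ dpow d α = x}

theorem dpow_mem_lowSpan {α : I →₀ ℕ} {k : ℕ} (h : α.degree < k) : dpow d α ∈ lowSpan d k :=
  Submodule.subset_span ⟨α, h, rfl⟩

theorem lowSpan_mono {k l : ℕ} (h : k ≤ l) : lowSpan d k ≤ lowSpan d l :=
  Submodule.span_mono fun _ ⟨α, hα, hx⟩ => ⟨α, hα.trans_le h, hx⟩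

theorem lowSpan_zero : lowSpan d 0 = ⊥ := by
  simp [lowSpan]

theorem IsColorDer.mul_smul_mem {f : Module.End F A} {δ : Γ} (hf : IsColorDer 𝒜 ε δ f)
    {M : Submodule A (Module.End F A)} {x : Module.End F A} (hx : x ∈ M) (hfx : f * x ∈ M)
    (a : A) : f * a • x ∈ M := by
  obtain ⟨s, hs⟩ := sum_proj_eq 𝒜 a
  rw [← hs, Finset.sum_smul, Finset.mul_sum]
  refine M.sum_mem fun lam _ => ?_
  rw [hf.mul_smul (proj_mem 𝒜 lam a)]
  exact M.add_mem (M.smul_mem _ hx) (M.smul_of_tower_mem _ (M.smul_mem _ hfx))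

theorem d_mul_mem_lowSpan (hdcc : ∀ i j, d i * d j = ε (δd i) (δd j) • (d j * d i))
    (hd : ∀ i, IsColorDer 𝒜 ε (δd i) (d i)) (i : I) {k : ℕ} {x : Module.End F A}
    (hx : x ∈ lowSpan d (k - 1)) : d i * x ∈ lowSpan d k := by
  rcases k with _ | k
  · rw [lowSpan_zero, Submodule.mem_bot] at hx
    rw [hx, mul_zero]
    exact zero_mem _
  rw [Nat.add_sub_cancel] at hx
  induction hx using Submodule.span_induction with
  | zero => rw [mul_zero]; exact zero_mem _
  | add x y _ _ hx hy => rw [mul_add]; exact add_mem hx hy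
  | smul a x hx hix => exact (hd i).mul_smul_mem (lowSpan_mono (Nat.le_succ k) hx) hix a
  | mem x hx =>
    obtain ⟨α, hα, rfl⟩ := hx
    rw [d_mul_dpow hdcc]
    refine Submodule.smul_of_tower_mem _ _ (dpow_mem_lowSpan ?_)
    rw [map_add, Finsupp.degree_single]
    lia

/-- The geometric sum `1 + q + ⋯ + q ^ (n - 1)` at `q = ε(δ, δ)`. -/
def colorNat (ε : Γ → Γ → F) (δ : Γ) (n : ℕ) : F := ∑ k ∈ Finset.range n, ε δ δ ^ k

theorem colorNat_succ (ε : Γ → Γ → F) (δ : Γ) (n : ℕ) :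
    colorNat ε δ (n + 1) = colorNat ε δ n * ε δ δ + 1 := by
  rw [colorNat, colorNat, Finset.sum_range_succ', Finset.sum_mul, pow_zero]
  simp only [pow_succ]

/-- The coefficient of `(d j b) d^(α - single j 1)` in `d^α ∘ b` for `b` of degree `mu`. -/
noncomputable def leibnizCoeff (ε : Γ → Γ → F) (δd : I → Γ) (mu : Γ) (α : I →₀ ℕ) (j : I) : F :=
  colorNat ε (δd j) (α j) * (swapSign ε δd j α)⁻¹ * ε (degJ δd (α - Finsupp.single j 1)) mu

theorem leibnizCoeff_zero {mu : Γ} {α : I →₀ ℕ} {j : I} (h : α j = 0) :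
    leibnizCoeff ε δd mu α j = 0 := by
  simp [leibnizCoeff, colorNat, h]

theorem swapSign_single_one_comm (hbich : IsBichar ε) {i j : I} (h : j ≠ i) :
    swapSign ε δd i (Finsupp.single j 1) =
      ε (δd i) (δd j) * swapSign ε δd j (Finsupp.single i 1) := by
  rw [swapSign_single, swapSign_single, pow_one, pow_one]
  rcases h.lt_or_gt with h | h
  · rw [if_pos h, if_neg h.not_gt, mul_one]
  · rw [if_pos h, if_neg h.not_gt, hbich.1]

theorem leibnizCoeff_add_single (hbich : IsBichar ε) (mu : Γ) (α : I →₀ ℕ) (i j : I) :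
    leibnizCoeff ε δd mu (α + Finsupp.single i 1) j =
      (if j = i then (swapSign ε δd i α)⁻¹ * ε (degJ δd α) mu else 0) +
      (swapSign ε δd i α)⁻¹ * (leibnizCoeff ε δd mu α j * ε (δd i) (mu + δd j) *
        swapSign ε δd i (α - Finsupp.single j 1)) := by
  rcases Nat.eq_zero_or_pos (α j) with h0 | h0
  · rw [leibnizCoeff_zero h0, zero_mul, zero_mul, mul_zero, add_zero]
    split_ifs with h
    · subst h
      simp [leibnizCoeff, h0, swapSign_add, swapSign_single, colorNat]
    · exact leibnizCoeff_zero (by simp [h0, Finsupp.single_eq_of_ne h])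
  · obtain ⟨β, rfl⟩ := exists_eq_add_single h0
    have hi := swapSign_ne_zero hbich δd i β
    have hj := swapSign_ne_zero hbich δd j β
    have hji := swapSign_ne_zero hbich δd j (Finsupp.single i 1)
    have hε := hbich.ne_zero (δd i) (δd j)
    split_ifs with h
    · subst h
      simp only [leibnizCoeff, add_tsub_cancel_right, swapSign_add, swapSign_single, lt_irrefl,
        if_false, mul_one, degJ_add, degJ_single_one, hbich.add_left, hbich.2, Finsupp.add_apply,
        Finsupp.single_eq_same, colorNat_succ ε _ (β j + 1)]
      field_simp
      ring
    · rw [add_right_comm]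
      simp only [leibnizCoeff, add_tsub_cancel_right, swapSign_add, Finsupp.add_apply,
        swapSign_single_one_comm hbich h, degJ_add, degJ_single_one, hbich.add_left, hbich.2,
        Finsupp.single_eq_same, Finsupp.single_eq_of_ne h, swapSign_single ε δd j j, lt_irrefl,
        if_false, add_zero, zero_add, mul_one]
      field_simp

theorem degree_sub_single {α : I →₀ ℕ} {j : I} (h : α j ≠ 0) :
    (α - Finsupp.single j 1).degree + 1 = α.degree := by
  obtain ⟨β, rfl⟩ := exists_eq_add_single (Nat.one_le_iff_ne_zero.2 h)
  rw [add_tsub_cancel_right, map_add, Finsupp.degree_single]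

/-- Leibniz rule for `d^α` up to terms of order at most `|α| - 2`. -/
theorem dpow_mul_mulL (hbich : IsBichar ε)
    (hdcc : ∀ i j, d i * d j = ε (δd i) (δd j) • (d j * d i))
    (hd : ∀ i, IsColorDer 𝒜 ε (δd i) (d i)) {mu : Γ} {b : A} (hb : b ∈ 𝒜 mu) (α : I →₀ ℕ) :
    ∃ x ∈ lowSpan d (α.degree - 1), dpow d α * mulL F A b = ε (degJ δd α) mu • b • dpow d α +
      ∑ j ∈ α.support, leibnizCoeff ε δd mu α j • d j b • dpow d (α - Finsupp.single j 1) + x := by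
  induction α using multiIndex_induction with
  | zero =>
    refine ⟨0, zero_mem _, ?_⟩
    rw [dpow_zero, degJ_zero, hbich.zero_left, one_smul, ← mulL_mul_eq_smul]
    simp
  | add_single α i ih =>
    obtain ⟨x, hx, hα⟩ := ih
    have hs := swapSign_ne_zero hbich δd i α
    have hdeg : (α + Finsupp.single i 1).degree - 1 = α.degree := by
      rw [map_add, Finsupp.degree_single, Nat.add_sub_cancel]
    refine ⟨(swapSign ε δd i α)⁻¹ • (∑ j ∈ α.support, leibnizCoeff ε δd mu α j •
      d i (d j b) • dpow d (α - Finsupp.single j 1) + d i * x), ?_, ?_⟩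
    · rw [hdeg]
      refine Submodule.smul_of_tower_mem _ _ (add_mem (sum_mem fun j hj => ?_)
        (d_mul_mem_lowSpan hdcc hd i hx))
      refine Submodule.smul_of_tower_mem _ _ (Submodule.smul_mem _ _ (dpow_mem_lowSpan ?_))
      have := degree_sub_single (Finsupp.mem_support_iff.1 hj)
      lia
    · have hterm : ∀ j ∈ α.support,
          d i * leibnizCoeff ε δd mu α j • d j b • dpow d (α - Finsupp.single j 1) =
          leibnizCoeff ε δd mu α j • d i (d j b) • dpow d (α - Finsupp.single j 1) +
          (leibnizCoeff ε δd mu α j * ε (δd i) (mu + δd j) *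
            swapSign ε δd i (α - Finsupp.single j 1)) • d j b •
              dpow d (α + Finsupp.single i 1 - Finsupp.single j 1) := by
        intro j hj
        obtain ⟨β, rfl⟩ :=
          exists_eq_add_single (Nat.one_le_iff_ne_zero.2 (Finsupp.mem_support_iff.1 hj))
        rw [mul_smul_comm, (hd i).mul_smul ((hd j).1 mu b hb), d_mul_dpow hdcc,
          add_right_comm β, add_tsub_cancel_right, add_tsub_cancel_right, smul_add,
          smul_comm (d j b) (swapSign ε δd i β), smul_smul, smul_smul]
      have hsum : ∑ j ∈ (α + Finsupp.single i 1).support,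
          leibnizCoeff ε δd mu (α + Finsupp.single i 1) j • d j b •
            dpow d (α + Finsupp.single i 1 - Finsupp.single j 1) =
          ((swapSign ε δd i α)⁻¹ * ε (degJ δd α) mu) • d i b • dpow d α +
          (swapSign ε δd i α)⁻¹ • ∑ j ∈ α.support, (leibnizCoeff ε δd mu α j *
            ε (δd i) (mu + δd j) * swapSign ε δd i (α - Finsupp.single j 1)) • d j b •
              dpow d (α + Finsupp.single i 1 - Finsupp.single j 1) := by
        have hi : i ∈ (α + Finsupp.single i 1).support := by simp
        have hsub : α.support ⊆ (α + Finsupp.single i 1).support := by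
          intro j hj
          simp only [Finsupp.mem_support_iff, Finsupp.add_apply] at hj ⊢
          lia
        simp only [leibnizCoeff_add_single hbich, add_smul, ite_smul, zero_smul,
          Finset.sum_add_distrib]
        rw [Finset.sum_ite_eq' _ i, if_pos hi, add_tsub_cancel_right, Finset.smul_sum]
        simp only [mul_smul (swapSign ε δd i α)⁻¹]
        congr 1
        refine (Finset.sum_subset hsub fun j _ hj => ?_).symm
        rw [leibnizCoeff_zero (Finsupp.notMem_support_iff.1 hj), zero_mul, zero_mul, zero_smul,
          smul_zero]
      rw [dpow_add_single hbich hdcc, smul_mul_assoc, mul_assoc, hα, mul_add, mul_add,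
        Finset.mul_sum, Finset.sum_congr rfl hterm, Finset.sum_add_distrib, mul_smul_comm,
        (hd i).mul_smul hb, hsum, degJ_add, degJ_single_one, hbich.add_left]
      simp only [smul_add, smul_smul]
      rw [smul_comm b (swapSign ε δd i α)⁻¹]
      simp only [smul_smul]
      rw [show (swapSign ε δd i α)⁻¹ * (ε (degJ δd α) mu * ε (δd i) mu) =
        ε (degJ δd α) mu * ε (δd i) mu * (swapSign ε δd i α)⁻¹ from mul_comm _ _]
      abel

end Filtration

section Spanning

variable {𝒜 : Γ → Submodule F A} [GradedAlgebra 𝒜] {ε : Γ → Γ → F}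
  {d : I → Module.End F A} {δd : I → Γ} {D : Submodule F (Module.End F A)}

/-- In characteristic `p`, the `p`-th power of an even color derivation is a color derivation. -/
theorem IsColorDer.pow_char (hbich : IsBichar ε) {δ : Γ} {f : Module.End F A}
    (hf : IsColorDer 𝒜 ε δ f) (hδ : ε δ δ = 1) {p : ℕ} [CharP F p] (hp : p.Prime) :
    IsColorDer 𝒜 ε (p • δ) (f ^ p) := by
  refine ⟨hf.1.pow p, fun lam a ha b => ?_⟩
  set σ : Module.End F A := diagOp 𝒜 (ε δ)
  have hσ : ∀ {mu : Γ} {a : A}, a ∈ 𝒜 mu → σ a = ε δ mu • a := fun ha => diagOp_apply 𝒜 _ ha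
  have hfσ : f * σ = σ * f := by
    refine end_ext_of_homogeneous 𝒜 fun mu a ha => ?_
    rw [Module.End.mul_apply, Module.End.mul_apply, hσ ha, hσ (hf.1 mu a ha), map_smul, hbich.2,
      hδ, mul_one]
  set P : Module.End F (TensorProduct F A A) := TensorProduct.map f 1
  set Q : Module.End F (TensorProduct F A A) := TensorProduct.map σ f
  have hPQ : Commute P Q := by
    change P * Q = Q * P
    rw [← TensorProduct.map_mul, ← TensorProduct.map_mul, hfσ, one_mul, mul_one]
  have hT : ∀ x, f (LinearMap.mul' F A x) = LinearMap.mul' F A ((P + Q) x) := by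
    intro x
    induction x using TensorProduct.induction_on with
    | zero => simp
    | add x y hx hy => simp only [map_add, hx, hy]
    | tmul a b =>
      induction a using DirectSum.Decomposition.inductionOn 𝒜 with
      | zero => simp
      | @homogeneous mu a =>
        simp [P, Q, hf.2 mu _ a.2, hσ a.2]
      | add x y hx hy => rw [TensorProduct.add_tmul]; simp only [map_add, hx, hy]
  have hTn : ∀ n : ℕ, ∀ x, (f ^ n) (LinearMap.mul' F A x) =
      LinearMap.mul' F A (((P + Q) ^ n) x) := by
    intro n
    induction n with
    | zero => simp
    | succ n ih =>
      intro x
      rw [pow_succ, Module.End.mul_apply, hT, ih, pow_succ, Module.End.mul_apply]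
  obtain ⟨r, hr⟩ := hPQ.exists_add_pow_prime_eq hp
  have hp0 : (p : Module.End F (TensorProduct F A A)) = 0 := by
    rw [← map_natCast (algebraMap F (Module.End F (TensorProduct F A A))), CharP.cast_eq_zero,
      map_zero]
  have hσp : ∀ n : ℕ, (σ ^ n) a = ε δ lam ^ n • a := by
    intro n
    induction n with
    | zero => simp
    | succ n ih => rw [pow_succ, Module.End.mul_apply, hσ ha, map_smul, ih, smul_smul, pow_succ']
  have h := hTn p (TensorProduct.tmul F a b)
  rw [hr, hp0, zero_mul, zero_mul, zero_mul, add_zero, TensorProduct.map_pow,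
    TensorProduct.map_pow, one_pow] at h
  simpa [hσp, hbich.nsmul_left] using h

/-- The left `A`-span of the `d^α` with `α ∈ 𝒥` and `|α| < k`. -/
noncomputable def redSpan (ε : Γ → Γ → F) (d : I → Module.End F A) (δd : I → Γ) (k : ℕ) :
    Submodule A (Module.End F A) :=
  Submodule.span A (dpow d '' {α | inJ ε δd α ∧ α.degree < k})

theorem d_sq_eq_zero (hchar : (2 : F) ≠ 0)
    (hdcc : ∀ i j, d i * d j = ε (δd i) (δd j) • (d j * d i)) {i : I}
    (h : ε (δd i) (δd i) = -1) : d i ^ 2 = 0 := by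
  have h2 : d i * d i = -(d i * d i) := by
    conv_lhs => rw [hdcc i i, h]
    exact neg_one_smul F (d i * d i)
  rw [eq_neg_iff_add_eq_zero, ← two_smul F] at h2
  rw [sq]
  exact (smul_eq_zero.1 h2).resolve_left hchar

theorem lowSpan_le_redSpan (hchar : (2 : F) ≠ 0) (hbich : IsBichar ε)
    (hdD : ∀ i, d i ∈ DScr 𝒜 ε D) (hdhom : ∀ i, IsColorDer 𝒜 ε (δd i) (d i))
    (hdcc : ∀ i j, d i * d j = ε (δd i) (δd j) • (d j * d i))
    (hdspan : ∀ f ∈ DScr 𝒜 ε D, ∃ (s : Finset I) (c : I → A),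
      (∀ i, c i ∈ F1 D) ∧ f = ∑ i ∈ s, mulL F A (c i) * d i) (k : ℕ) :
    lowSpan d k ≤ redSpan ε d δd k := by
  have main : ∀ n, ∀ α : I →₀ ℕ, α.degree = n → n < k → dpow d α ∈ redSpan ε d δd k := by
    intro n
    induction n using Nat.strong_induction_on with
    | _ n ih =>
      intro α hα hn
      by_cases hJ : inJ ε δd α
      · exact Submodule.subset_span ⟨α, ⟨hJ, hα ▸ hn⟩, rfl⟩
      by_cases hodd : ∃ i, ε (δd i) (δd i) = -1 ∧ 2 ≤ α i
      · obtain ⟨i, hi, h2⟩ := hodd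
        obtain ⟨β, rfl⟩ := exists_eq_add_single h2
        obtain ⟨c, hc⟩ := d_pow_mul_dpow hbich hdcc i β 2
        rw [hc, d_sq_eq_zero hchar hdcc hi, zero_mul, smul_zero]
        exact zero_mem _
      push Not at hodd
      have heven : ∃ i, ringChar F ≠ 0 ∧ ringChar F ≤ α i := by
        by_contra! hcon
        exact hJ ⟨fun i h => Nat.le_pred_of_lt (hcon i h), fun i h =>
          Nat.lt_succ_iff.1 (hodd i h)⟩
      obtain ⟨i, hp0, hpi⟩ := heven
      have hp : (ringChar F).Prime := (CharP.char_is_prime_or_zero F _).resolve_right hp0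
      have hi : ε (δd i) (δd i) = 1 := (hbich.self_eq _).resolve_right fun h =>
        absurd (hodd i h) (not_lt.2 (hp.two_le.trans hpi))
      obtain ⟨β, rfl⟩ := exists_eq_add_single hpi
      obtain ⟨c, hc⟩ := d_pow_mul_dpow hbich hdcc i β (ringChar F)
      obtain ⟨s, a, -, ha⟩ := hdspan (d i ^ ringChar F) ⟨pow_mem (hdD i).1 _,
        Submodule.subset_span ⟨_, (hdhom i).pow_char hbich hi hp⟩⟩
      rw [hc, ha, Finset.sum_mul]
      refine Submodule.smul_of_tower_mem _ _ (sum_mem fun j _ => ?_)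
      rw [mul_assoc, mulL_mul_eq_smul, d_mul_dpow hdcc]
      refine Submodule.smul_mem _ _ (Submodule.smul_of_tower_mem _ _ ?_)
      have h2 := hp.two_le
      rw [map_add, Finsupp.degree_single] at hα
      refine ih (β.degree + 1) (by lia) _ ?_ (by lia)
      rw [map_add, Finsupp.degree_single]
  refine Submodule.span_le.2 ?_
  rintro _ ⟨α, hα, rfl⟩
  exact main _ α rfl hα

theorem subset_DScr (hDder : D ≤ DerE 𝒜 ε) {f : Module.End F A} (hf : f ∈ D) :
    f ∈ DScr 𝒜 ε D :=
  ⟨Algebra.subset_adjoin (Or.inr hf), hDder hf⟩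

theorem exists_mem_lowSpan (hDder : D ≤ DerE 𝒜 ε)
    (hdhom : ∀ i, IsColorDer 𝒜 ε (δd i) (d i))
    (hdcc : ∀ i j, d i * d j = ε (δd i) (δd j) • (d j * d i))
    (hdspan : ∀ f ∈ DScr 𝒜 ε D, ∃ (s : Finset I) (c : I → A),
      (∀ i, c i ∈ F1 D) ∧ f = ∑ i ∈ s, mulL F A (c i) * d i)
    {x : Module.End F A} (hx : x ∈ AD D) : ∃ k, x ∈ lowSpan d k := by
  have key : ∀ k, ∀ y ∈ lowSpan d k, ∃ l, x * y ∈ lowSpan d l := by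
    induction hx using Algebra.adjoin_induction with
    | mem x hx =>
      intro k y hy
      rcases hx with ⟨a, rfl⟩ | hx
      · exact ⟨k, Submodule.smul_mem _ a hy⟩
      · obtain ⟨s, c, -, rfl⟩ := hdspan x (subset_DScr hDder hx)
        refine ⟨k + 1, ?_⟩
        rw [Finset.sum_mul]
        refine sum_mem fun i _ => ?_
        rw [mul_assoc]
        exact Submodule.smul_mem _ _ (d_mul_mem_lowSpan hdcc hdhom i hy)
    | algebraMap r =>
      intro k y hy
      exact ⟨k, by rw [← Algebra.smul_def]; exact Submodule.smul_of_tower_mem _ r hy⟩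
    | add x y _ _ hx hy =>
      intro k z hz
      obtain ⟨l, hl⟩ := hx k z hz
      obtain ⟨m, hm⟩ := hy k z hz
      exact ⟨max l m, by
        rw [add_mul]
        exact add_mem (lowSpan_mono (le_max_left l m) hl) (lowSpan_mono (le_max_right l m) hm)⟩
    | mul x y _ _ hx hy =>
      intro k z hz
      obtain ⟨l, hl⟩ := hy k z hz
      rw [mul_assoc]
      exact hx l _ hl
  have h1 : (1 : Module.End F A) ∈ lowSpan d 1 := by
    rw [← dpow_zero d]
    exact dpow_mem_lowSpan (by simp)
  simpa using key 1 1 h1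

end Spanning

section Independence

variable {𝒜 : Γ → Submodule F A} [GradedAlgebra 𝒜] {ε : Γ → Γ → F}
  {d : I → Module.End F A} {δd : I → Γ} {D : Submodule F (Module.End F A)}

/-- Apply a family of linear maps to the coefficients of a formal combination of the `d^α`. -/
noncomputable def mapCoeff (φ : (I →₀ ℕ) → Module.End F A) (c : (I →₀ ℕ) →₀ A) :
    (I →₀ ℕ) →₀ A :=
  Finsupp.onFinset c.support (fun α => φ α (c α)) fun α h =>
    Finsupp.mem_support_iff.2 fun h0 => h (by rw [h0, map_zero])

theorem mapCoeff_apply (φ : (I →₀ ℕ) → Module.End F A) (c : (I →₀ ℕ) →₀ A) (α : I →₀ ℕ) :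
    mapCoeff φ c α = φ α (c α) :=
  rfl

theorem mapCoeff_mem_supported (φ : (I →₀ ℕ) → Module.End F A) {c : (I →₀ ℕ) →₀ A}
    {S : Set (I →₀ ℕ)} (hc : c ∈ Finsupp.supported A A S) :
    mapCoeff φ c ∈ Finsupp.supported A A S :=
  fun _ hα => hc (Finsupp.support_onFinset_subset hα)

theorem linearCombination_mapCoeff (φ : (I →₀ ℕ) → Module.End F A) (c : (I →₀ ℕ) →₀ A) :
    Finsupp.linearCombination A (dpow d) (mapCoeff φ c) =
      ∑ α ∈ c.support, φ α (c α) • dpow d α := by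
  rw [Finsupp.linearCombination_apply]
  exact Finsupp.sum_of_support_subset _ Finsupp.support_onFinset_subset _ fun _ _ => zero_smul _ _

theorem proj_mul_of_mem {lam mu : Γ} (a : A) {b : A} (hb : b ∈ 𝒜 mu) :
    GradedAlgebra.proj 𝒜 (lam + mu) (a * b) = GradedAlgebra.proj 𝒜 lam a * b := by
  have h : IsHomogMap 𝒜 mu (LinearMap.mulRight F b) :=
    fun _ _ ha => SetLike.mul_mem_graded ha hb
  exact h.proj_apply 𝒜 lam a

/-- Homogeneous components of a relation among the `d^α` are relations. -/
theorem relation_proj (hdhom : ∀ α, IsHomogMap 𝒜 (degJ δd α) (dpow d α)) {c : (I →₀ ℕ) →₀ A}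
    (hc : Finsupp.linearCombination A (dpow d) c = 0) (ν : Γ) :
    Finsupp.linearCombination A (dpow d)
      (mapCoeff (fun α => GradedAlgebra.proj 𝒜 (ν - degJ δd α)) c) = 0 := by
  rw [linearCombination_mapCoeff]
  refine end_ext_of_homogeneous 𝒜 fun lam a ha => ?_
  have h := congrArg (GradedAlgebra.proj 𝒜 (lam + ν)) (LinearMap.congr_fun hc a)
  rw [Finsupp.linearCombination_apply, Finsupp.sum, LinearMap.sum_apply, map_sum,
    LinearMap.zero_apply, map_zero] at h
  rw [LinearMap.sum_apply, LinearMap.zero_apply, ← h]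
  refine Finset.sum_congr rfl fun α _ => ?_
  rw [LinearMap.smul_apply, LinearMap.smul_apply, smul_eq_mul, smul_eq_mul,
    ← proj_mul_of_mem _ (hdhom α lam a ha)]
  congr 2
  abel

/-- Derivations in `D` map homogeneous relations among the `d^α` to relations. -/
theorem relation_derivation (hbich : IsBichar ε) {f : Module.End F A} {δ : Γ}
    (hf : IsColorDer 𝒜 ε δ f)
    (hfd : ∀ α, f * dpow d α = ε δ (degJ δd α) • (dpow d α * f)) {c : (I →₀ ℕ) →₀ A} {ν : Γ}
    (hν : ∀ α, c α ∈ 𝒜 (ν - degJ δd α)) (hc : Finsupp.linearCombination A (dpow d) c = 0) :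
    Finsupp.linearCombination A (dpow d) (mapCoeff (fun _ => f) c) = 0 := by
  rw [linearCombination_mapCoeff]
  rw [Finsupp.linearCombination_apply, Finsupp.sum] at hc
  have hterm : ∀ α ∈ c.support, f * c α • dpow d α =
      f (c α) • dpow d α + ε δ ν • (c α • dpow d α * f) := by
    intro α _
    rw [hf.mul_smul (hν α), hfd, smul_comm (c α), smul_smul, ← hbich.2, sub_add_cancel,
      smul_mul_assoc]
  have h : f * ∑ α ∈ c.support, c α • dpow d α = 0 := by rw [hc, mul_zero]
  rwa [Finset.mul_sum, Finset.sum_congr rfl hterm, Finset.sum_add_distrib, ← Finset.smul_sum,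
    ← Finset.sum_mul, hc, zero_mul, smul_zero, add_zero] at h

/-- A nontrivial relation with a nonzero coefficient at `α₀` yields, by graded `D`-simplicity, a
homogeneous relation of the same support type with coefficient `1` at `α₀`. -/
theorem exists_monic_relation (hbich : IsBichar ε) (hDgr : DGraded 𝒜 ε D)
    (hsimple : GradedDSimple 𝒜 D)
    (hdhom : ∀ α, IsHomogMap 𝒜 (degJ δd α) (dpow d α))
    (hDd : ∀ δ, ∀ f ∈ D, IsColorDer 𝒜 ε δ f →
      ∀ α, f * dpow d α = ε δ (degJ δd α) • (dpow d α * f))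
    {S : Set (I →₀ ℕ)} {α₀ : I →₀ ℕ} {c : (I →₀ ℕ) →₀ A}
    (hcS : c ∈ Finsupp.supported A A S) (hc : Finsupp.linearCombination A (dpow d) c = 0)
    (hcα₀ : c α₀ ≠ 0) :
    ∃ c' ∈ Finsupp.supported A A S, Finsupp.linearCombination A (dpow d) c' = 0 ∧ c' α₀ = 1 ∧
      ∀ α, c' α ∈ 𝒜 (degJ δd α₀ - degJ δd α) := by
  let J : Ideal A := Submodule.map (Finsupp.lapply α₀ : ((I →₀ ℕ) →₀ A) →ₗ[A] A)
    (Finsupp.supported A A S ⊓ LinearMap.ker (Finsupp.linearCombination A (dpow d)))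
  have hproj : ∀ ν, ∀ c ∈ Finsupp.supported A A S, Finsupp.linearCombination A (dpow d) c = 0 →
      ∃ c' ∈ Finsupp.supported A A S, Finsupp.linearCombination A (dpow d) c' = 0 ∧
        c' α₀ = GradedAlgebra.proj 𝒜 ν (c α₀) ∧
        ∀ α, c' α ∈ 𝒜 (ν + degJ δd α₀ - degJ δd α) := by
    intro ν c hcS hc
    refine ⟨_, mapCoeff_mem_supported _ hcS, relation_proj hdhom hc (ν + degJ δd α₀), ?_, ?_⟩
    · rw [mapCoeff_apply, add_sub_cancel_right]
    · intro α
      exact proj_mem 𝒜 _ _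
  have hJ : J = ⊤ := by
    refine (hsimple J ?_ ?_).resolve_left ?_
    · rintro ν _ ⟨c, ⟨hcS, hc⟩, rfl⟩
      obtain ⟨c', hcS', hc', hα₀, -⟩ := hproj ν c hcS hc
      exact ⟨c', ⟨hcS', hc'⟩, hα₀⟩
    · intro f hf
      rw [hDgr] at hf
      induction hf using Submodule.span_induction with
      | mem f hf =>
        obtain ⟨hfD, δ, hδ⟩ := hf
        rintro _ ⟨c, ⟨hcS, hc⟩, rfl⟩
        obtain ⟨s, hs⟩ := sum_proj_eq 𝒜 (c α₀)
        rw [Finsupp.lapply_apply, ← hs, map_sum]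
        refine J.sum_mem fun ν _ => ?_
        obtain ⟨c', hcS', hc', hα₀, hhom⟩ := hproj ν c hcS hc
        rw [← hα₀]
        exact ⟨_, ⟨mapCoeff_mem_supported _ hcS',
          relation_derivation hbich hδ (hDd δ f hfD hδ) hhom hc'⟩, rfl⟩
      | zero => intro x _; exact J.zero_mem
      | add f g _ _ hf hg => intro x hx; exact J.add_mem (hf x hx) (hg x hx)
      | smul r f _ hf => intro x hx; exact Submodule.smul_of_tower_mem J r (hf x hx)
    · intro hbot
      have hmem : c α₀ ∈ J := ⟨c, ⟨hcS, hc⟩, rfl⟩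
      rw [hbot] at hmem
      exact hcα₀ hmem
  obtain ⟨c₁, ⟨hcS₁, hc₁⟩, h1⟩ : (1 : A) ∈ J := hJ ▸ Submodule.mem_top
  obtain ⟨c', hcS', hc', hα₀, hhom⟩ := hproj 0 c₁ hcS₁ hc₁
  refine ⟨c', hcS', hc', ?_, by simpa using hhom⟩
  rw [hα₀, show c₁ α₀ = 1 from h1, proj_of_mem 𝒜 SetLike.GradedOne.one_mem]

theorem inJ_sub_single {α : I →₀ ℕ} (h : inJ ε δd α) (j : I) :
    inJ ε δd (α - Finsupp.single j 1) :=
  ⟨fun i hi => (Nat.sub_le _ _).trans (h.1 i hi), fun i hi => (Nat.sub_le _ _).trans (h.2 i hi)⟩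

theorem colorNat_ne_zero (hbich : IsBichar ε) {α : I →₀ ℕ} (h : inJ ε δd α) {i : I}
    (hi : α i ≠ 0) : colorNat ε (δd i) (α i) ≠ 0 := by
  rcases hbich.self_eq (δd i) with h1 | h1
  · simp only [colorNat, h1, one_pow, Finset.sum_const, Finset.card_range, nsmul_eq_mul, mul_one]
    intro h0
    have hdvd := (ringChar.spec F _).1 h0
    rcases eq_or_ne (ringChar F) 0 with hp | hp
    · rw [hp, zero_dvd_iff] at hdvd
      exact hi hdvd
    · have := Nat.le_of_dvd (Nat.pos_of_ne_zero hi) hdvd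
      have := h.1 i hp
      lia
  · have : α i = 1 := le_antisymm (h.2 i h1) (Nat.one_le_iff_ne_zero.2 hi)
    simp [colorNat, this]

/-- A homogeneous relation with constant coefficients yields relations among the `d j`, by taking
color commutators with left multiplications. -/
theorem leading_coeff_relation (hbich : IsBichar ε) (hcomm : IsColorComm 𝒜 ε)
    (hdhom : ∀ i, IsColorDer 𝒜 ε (δd i) (d i))
    (hdcc : ∀ i j, d i * d j = ε (δd i) (δd j) • (d j * d i))
    (hred : ∀ k, lowSpan d k ≤ redSpan ε d δd k) {n : ℕ}
    (hind : ∀ c ∈ Finsupp.supported A A {α | inJ ε δd α ∧ α.degree < n},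
      Finsupp.linearCombination A (dpow d) c = 0 → c = 0)
    {c : (I →₀ ℕ) →₀ A} (hcS : c ∈ Finsupp.supported A A {α | inJ ε δd α ∧ α.degree ≤ n})
    (hc : Finsupp.linearCombination A (dpow d) c = 0) {ν : Γ}
    (hν : ∀ α, c α ∈ 𝒜 (ν - degJ δd α)) {γ : I →₀ ℕ} (hγ : γ.degree + 1 = n) :
    ∑ j ∈ c.support.biUnion Finsupp.support,
      mulL F A ((colorNat ε (δd j) (γ j + 1) * (swapSign ε δd j γ)⁻¹) •
        c (γ + Finsupp.single j 1)) * d j = 0 := by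
  refine end_ext_of_homogeneous 𝒜 fun mu b hb => ?_
  choose x hx hleib using fun α => dpow_mul_mulL hbich hdcc hdhom hb α
  -- the formal combination representing the terms of the commutator with one derivative on `b`
  let Y : (I →₀ ℕ) →₀ A := ∑ α ∈ c.support, ∑ j ∈ α.support,
    Finsupp.single (α - Finsupp.single j 1) (leibnizCoeff ε δd mu α j • (c α * d j b))
  have hYS : Y ∈ Finsupp.supported A A {α | inJ ε δd α ∧ α.degree < n} := by
    refine sum_mem fun α hα => sum_mem fun j hj => Finsupp.single_mem_supported _ _ ?_
    have h := hcS hα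
    have := degree_sub_single (Finsupp.mem_support_iff.1 hj)
    exact ⟨inJ_sub_single h.1 j, by have := h.2; lia⟩
  have hY : Finsupp.linearCombination A (dpow d) Y = -∑ α ∈ c.support, c α • x α := by
    rw [Finsupp.linearCombination_apply, Finsupp.sum] at hc
    have h0 : ∑ α ∈ c.support, c α • (dpow d α * mulL F A b) = 0 := by
      simp only [← smul_mul_assoc]
      rw [← Finset.sum_mul, hc, zero_mul]
    have h1 : ∑ α ∈ c.support, c α • (ε (degJ δd α) mu • b • dpow d α) = 0 := by
      have hterm : ∀ α ∈ c.support, c α • (ε (degJ δd α) mu • b • dpow d α) =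
          ε ν mu • b • (c α • dpow d α) := by
        intro α _
        rw [smul_comm (c α), smul_smul (c α), smul_smul b, hcomm _ _ _ (hν α) b hb,
          smul_assoc (ε _ mu), smul_smul, ← hbich.add_left, add_sub_cancel]
      rw [Finset.sum_congr rfl hterm, ← Finset.smul_sum, ← Finset.smul_sum, hc, smul_zero,
        smul_zero]
    rw [eq_neg_iff_add_eq_zero, ← h0]
    simp only [hleib, smul_add, Finset.sum_add_distrib]
    rw [h1, zero_add]
    congr 1
    simp only [Y, map_sum, Finsupp.linearCombination_single, Finset.smul_sum]
    refine Finset.sum_congr rfl fun α _ => Finset.sum_congr rfl fun j _ => ?_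
    rw [smul_assoc, smul_comm (c α), smul_smul (c α)]
  have hlow : Finsupp.linearCombination A (dpow d) Y ∈ redSpan ε d δd (n - 1) := by
    refine hred _ ?_
    rw [hY]
    refine neg_mem (sum_mem fun α hα => Submodule.smul_mem _ _ (lowSpan_mono ?_ (hx α)))
    exact Nat.sub_le_sub_right (hcS hα).2 1
  obtain ⟨Z, hZS, hZ⟩ := (Finsupp.mem_span_image_iff_linearCombination A).1 hlow
  have hYZ : Y - Z = 0 := by
    refine hind _ (sub_mem hYS (Finsupp.supported_mono ?_ hZS)) (by rw [map_sub, hZ, sub_self])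
    exact fun α hα => ⟨hα.1, hα.2.trans_le (Nat.sub_le _ _)⟩
  have hYγ : Y γ = 0 := by
    rw [sub_eq_zero.1 hYZ]
    exact (Finsupp.mem_supported' A Z).1 hZS γ fun h => by have := h.2; lia
  have hYsum : Y γ = ∑ j ∈ c.support.biUnion Finsupp.support,
      leibnizCoeff ε δd mu (γ + Finsupp.single j 1) j • (c (γ + Finsupp.single j 1) * d j b) := by
    have hext : ∀ α ∈ c.support, ∀ j ∈ c.support.biUnion Finsupp.support, j ∉ α.support →
        Finsupp.single (α - Finsupp.single j 1)
          (leibnizCoeff ε δd mu α j • (c α * d j b)) γ = 0 := by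
      intro α _ j _ hj
      rw [leibnizCoeff_zero (Finsupp.notMem_support_iff.1 hj), zero_smul, Finsupp.single_zero,
        Finsupp.zero_apply]
    simp only [Y, Finsupp.finsetSum_apply]
    rw [Finset.sum_congr rfl fun α hα => Finset.sum_subset
      (Finset.subset_biUnion_of_mem Finsupp.support hα) (hext α hα), Finset.sum_comm]
    refine Finset.sum_congr rfl fun j _ => ?_
    rw [Finset.sum_eq_single (γ + Finsupp.single j 1)]
    · rw [add_tsub_cancel_right, Finsupp.single_eq_same]
    · intro α _ hα
      by_cases hj : α j = 0
      · rw [leibnizCoeff_zero hj, zero_smul, Finsupp.single_zero, Finsupp.zero_apply]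
      · obtain ⟨β, rfl⟩ := exists_eq_add_single (Nat.one_le_iff_ne_zero.2 hj)
        rw [add_tsub_cancel_right]
        exact Finsupp.single_eq_of_ne fun h => hα (by rw [h])
    · intro h
      rw [Finsupp.notMem_support_iff.1 h, zero_mul, smul_zero, Finsupp.single_zero,
        Finsupp.zero_apply]
  rw [hYγ] at hYsum
  have hε := hbich.ne_zero (degJ δd γ) mu
  refine (smul_eq_zero.1 ?_).resolve_left hε
  rw [LinearMap.sum_apply, Finset.smul_sum, hYsum]
  refine Finset.sum_congr rfl fun j _ => ?_
  rw [mulL_mul_eq_smul, LinearMap.smul_apply, smul_assoc, smul_smul, leibnizCoeff,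
    add_tsub_cancel_right, swapSign_add, swapSign_single, if_neg (lt_irrefl j), mul_one,
    Finsupp.add_apply, Finsupp.single_eq_same, mul_comm, smul_eq_mul]

/-- Enlarging the set of admissible exponents by one multi-index of top order keeps the `d^α`
independent. -/
theorem independent_insert [Nontrivial A] (hbich : IsBichar ε) (hcomm : IsColorComm 𝒜 ε)
    (hDgr : DGraded 𝒜 ε D) (hsimple : GradedDSimple 𝒜 D)
    (hdhom : ∀ i, IsColorDer 𝒜 ε (δd i) (d i))
    (hdcc : ∀ i j, d i * d j = ε (δd i) (δd j) • (d j * d i))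
    (hDd : ∀ δ, ∀ f ∈ D, IsColorDer 𝒜 ε δ f →
      ∀ α, f * dpow d α = ε δ (degJ δd α) • (dpow d α * f))
    (hred : ∀ k, lowSpan d k ≤ redSpan ε d δd k)
    (hdind : ∀ (s : Finset I) (c : I → A), (∀ i, c i ∈ F1 D) →
      (∑ i ∈ s, mulL F A (c i) * d i) = 0 → ∀ i ∈ s, c i = 0)
    {S : Set (I →₀ ℕ)} {α₀ : I →₀ ℕ} (hα₀ : inJ ε δd α₀) (hα₀S : α₀ ∉ S)
    (hSle : S ⊆ {α | inJ ε δd α ∧ α.degree ≤ α₀.degree})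
    (hSge : {α | inJ ε δd α ∧ α.degree < α₀.degree} ⊆ S)
    (hS : ∀ c ∈ Finsupp.supported A A S, Finsupp.linearCombination A (dpow d) c = 0 → c = 0) :
    ∀ c ∈ Finsupp.supported A A (insert α₀ S),
      Finsupp.linearCombination A (dpow d) c = 0 → c = 0 := by
  intro c hcS hc
  have hdrop : ∀ c ∈ Finsupp.supported A A (insert α₀ S), c α₀ = 0 →
      c ∈ Finsupp.supported A A S := fun c hc h0 α hα =>
    (hc hα).resolve_left fun h => Finsupp.mem_support_iff.1 hα (h ▸ h0)
  by_contra hne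
  have hcα₀ : c α₀ ≠ 0 := fun h0 => hne (hS c (hdrop c hcS h0) hc)
  obtain ⟨e, heS, he, he1, hhom⟩ := exists_monic_relation hbich hDgr hsimple
    (isHomogMap_dpow hbich hdcc fun i => (hdhom i).1) hDd hcS hc hcα₀
  have heF : ∀ α, e α ∈ F1 D := by
    intro α f hf
    rw [hDgr] at hf
    induction hf using Submodule.span_induction with
    | mem f hf =>
      obtain ⟨hfD, δ, hδ⟩ := hf
      have h1 : f 1 = 0 := by
        have h := hδ.2 0 1 SetLike.GradedOne.one_mem 1
        rw [hbich.zero_right, one_smul, one_mul, mul_one] at h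
        simpa using h
      have h0 := hS _ (hdrop _ (mapCoeff_mem_supported (fun _ => f) heS)
        (by rw [mapCoeff_apply, he1, h1])) (relation_derivation hbich hδ (hDd δ f hfD hδ) hhom he)
      exact DFunLike.congr_fun h0 α
    | zero => rfl
    | add f g _ _ hf hg => rw [LinearMap.add_apply, hf, hg, add_zero]
    | smul r f _ hf => rw [LinearMap.smul_apply, hf, smul_zero]
  rcases eq_or_ne α₀ 0 with rfl | h0
  · have hSempty : ∀ α ∈ S, False := fun α hα => by
      have hdeg := (hSle hα).2
      rw [map_zero, Nat.le_zero, Finsupp.degree_eq_zero_iff] at hdeg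
      exact hα₀S (hdeg ▸ hα)
    have hsupp : e = Finsupp.single 0 1 := by
      ext α
      rcases eq_or_ne α 0 with rfl | hα
      · rw [he1, Finsupp.single_eq_same]
      · rw [Finsupp.single_eq_of_ne hα]
        exact (Finsupp.mem_supported' A e).1 heS α fun h => h.elim hα (hSempty α)
    rw [hsupp, Finsupp.linearCombination_single, one_smul, dpow_zero] at he
    exact one_ne_zero (LinearMap.congr_fun he 1)
  · obtain ⟨i, hi⟩ := Finsupp.ne_iff.1 h0
    obtain ⟨γ, rfl⟩ := exists_eq_add_single (Nat.one_le_iff_ne_zero.2 hi)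
    have hrel := leading_coeff_relation hbich hcomm hdhom hdcc hred
      (n := (γ + Finsupp.single i 1).degree)
      (fun c hc => hS c (Finsupp.supported_mono hSge hc))
      (Finsupp.supported_mono (Set.insert_subset (Set.mem_ofPred.2 ⟨hα₀, le_rfl⟩) hSle) heS) he hhom
      (γ := γ) (by rw [map_add, Finsupp.degree_single])
    have hmem : i ∈ e.support.biUnion Finsupp.support :=
      Finset.mem_biUnion.2 ⟨_, Finsupp.mem_support_iff.2 (by rw [he1]; exact one_ne_zero),
        Finsupp.mem_support_iff.2 hi⟩
    have hzero := hdind _ _ (fun j => Submodule.smul_mem _ _ (heF _)) hrel i hmem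
    rw [he1, smul_eq_zero, or_iff_left one_ne_zero, mul_eq_zero] at hzero
    have hnat := colorNat_ne_zero hbich hα₀ hi
    rw [Finsupp.add_apply, Finsupp.single_eq_same] at hnat
    exact hzero.elim hnat (inv_ne_zero (swapSign_ne_zero hbich δd i γ))

theorem dpow_independent [Nontrivial A] (hbich : IsBichar ε) (hcomm : IsColorComm 𝒜 ε)
    (hDgr : DGraded 𝒜 ε D) (hsimple : GradedDSimple 𝒜 D)
    (hdhom : ∀ i, IsColorDer 𝒜 ε (δd i) (d i))
    (hdcc : ∀ i j, d i * d j = ε (δd i) (δd j) • (d j * d i))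
    (hDd : ∀ δ, ∀ f ∈ D, IsColorDer 𝒜 ε δ f →
      ∀ α, f * dpow d α = ε δ (degJ δd α) • (dpow d α * f))
    (hred : ∀ k, lowSpan d k ≤ redSpan ε d δd k)
    (hdind : ∀ (s : Finset I) (c : I → A), (∀ i, c i ∈ F1 D) →
      (∑ i ∈ s, mulL F A (c i) * d i) = 0 → ∀ i ∈ s, c i = 0) {c : (I →₀ ℕ) →₀ A}
    (hcJ : ∀ α ∈ c.support, inJ ε δd α) (hc : Finsupp.linearCombination A (dpow d) c = 0) :
    c = 0 := by
  have main : ∀ n, ∀ c ∈ Finsupp.supported A A {α | inJ ε δd α ∧ α.degree < n},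
      Finsupp.linearCombination A (dpow d) c = 0 → c = 0 := by
    intro n
    induction n with
    | zero =>
      intro c hc _
      ext α
      exact (Finsupp.mem_supported' A c).1 hc α fun h => Nat.not_lt_zero _ h.2
    | succ n ih =>
      have step : ∀ T : Finset (I →₀ ℕ), (∀ α ∈ T, inJ ε δd α ∧ α.degree = n) →
          ∀ c ∈ Finsupp.supported A A (↑T ∪ {α | inJ ε δd α ∧ α.degree < n}),
          Finsupp.linearCombination A (dpow d) c = 0 → c = 0 := by
        intro T
        induction T using Finset.induction_on with
        | empty => intro _ c hc; exact ih c (by simpa using hc)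
        | insert α₀ T hα₀T ihT =>
          intro hT
          obtain ⟨hα₀, rfl⟩ := hT α₀ (Finset.mem_insert_self _ _)
          have hT' : ∀ α ∈ T, inJ ε δd α ∧ α.degree = α₀.degree := fun α hα =>
            hT α (Finset.mem_insert_of_mem hα)
          rw [Finset.coe_insert, Set.insert_union]
          refine independent_insert hbich hcomm hDgr hsimple hdhom hdcc hDd hred hdind hα₀ ?_ ?_
            Set.subset_union_right (ihT hT')
          · exact fun h => h.elim hα₀T fun h => lt_irrefl _ h.2
          · exact Set.union_subset (fun α hα => ⟨(hT' α hα).1, (hT' α hα).2.le⟩)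
              fun α hα => ⟨hα.1, hα.2.le⟩
      intro c hcS hc
      classical
      refine step (c.support.filter fun α => α.degree = n) ?_ c ?_ hc
      · intro α hα
        rw [Finset.mem_filter] at hα
        exact ⟨(hcS hα.1).1, hα.2⟩
      · intro α hα
        rcases (Nat.lt_succ_iff.1 (hcS hα).2).eq_or_lt with h | h
        · exact Or.inl (Finset.mem_coe.2 (Finset.mem_filter.2 ⟨hα, h⟩))
        · exact Or.inr ⟨(hcS hα).1, h⟩
  refine main (c.support.sup Finsupp.degree + 1) c (fun α hα => ⟨hcJ α hα, ?_⟩) hc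
  exact Nat.lt_succ_of_le (Finset.le_sup (f := Finsupp.degree) hα)

end Independence

theorem stmt_7
    (𝒜 : Γ → Submodule F A) [GradedAlgebra 𝒜] (ε : Γ → Γ → F)
    (D : Submodule F (Module.End F A))
    (hchar : (2 : F) ≠ 0)
    (hbich : IsBichar ε)
    (hcomm : IsColorComm 𝒜 ε)
    (hDder : D ≤ DerE 𝒜 ε)
    (hDgr : DGraded 𝒜 ε D)
    (hDcc : DColorComm 𝒜 ε D)
    (hDne : D ≠ ⊥)
    (hsimple : GradedDSimple 𝒜 D)
    (d : I → Module.End F A) (δd : I → Γ)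
    (hdD : ∀ i, d i ∈ DScr 𝒜 ε D)
    (hdhom : ∀ i, IsColorDer 𝒜 ε (δd i) (d i))
    (hdspan : ∀ f ∈ DScr 𝒜 ε D, ∃ (s : Finset I) (c : I → A),
      (∀ i, c i ∈ F1 D) ∧ f = ∑ i ∈ s, mulL F A (c i) * d i)
    (hdind : ∀ (s : Finset I) (c : I → A), (∀ i, c i ∈ F1 D) →
      (∑ i ∈ s, mulL F A (c i) * d i) = 0 → ∀ i ∈ s, c i = 0)
    :
    (∀ x ∈ AD D, ∃ (s : Finset (I →₀ ℕ)) (c : (I →₀ ℕ) → A),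
        (∀ α ∈ s, inJ ε δd α) ∧ x = ∑ α ∈ s, mulL F A (c α) * dpow d α) ∧
    (∀ (s : Finset (I →₀ ℕ)) (c : (I →₀ ℕ) → A), (∀ α ∈ s, inJ ε δd α) →
        (∑ α ∈ s, mulL F A (c α) * dpow d α) = 0 →
        ∀ α ∈ s, mulL F A (c α) * dpow d α = 0) := by
  have hdcc : ∀ i j, d i * d j = ε (δd i) (δd j) • (d j * d i) := fun i j =>
    F1D_color_comm hbich hcomm hDgr hDcc (hdD i).1 (hdD j).1 (hdhom i).1 (hdhom j).1
  have hDd : ∀ δ, ∀ f ∈ D, IsColorDer 𝒜 ε δ f →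
      ∀ α, f * dpow d α = ε δ (degJ δd α) • (dpow d α * f) := fun δ f hfD hf α =>
    F1D_color_comm hbich hcomm hDgr hDcc (subset_DScr hDder hfD).1
      (dpow_mem (fun i => (hdD i).1) α) hf.1
      (isHomogMap_dpow hbich hdcc (fun i => (hdhom i).1) α)
  have hred := lowSpan_le_redSpan hchar hbich hdD hdhom hdcc hdspan
  have hA : Nontrivial A := by
    by_contra h
    rw [not_nontrivial_iff_subsingleton] at h
    exact hDne (Subsingleton.elim _ _)
  refine ⟨fun x hx => ?_, fun s c hs hsum α hα => ?_⟩
  · obtain ⟨k, hk⟩ := exists_mem_lowSpan hDder hdhom hdcc hdspan hx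
    obtain ⟨l, hl, rfl⟩ := (Finsupp.mem_span_image_iff_linearCombination A).1 (hred k hk)
    exact ⟨l.support, l, fun α hα => (hl hα).1, Finsupp.linearCombination_apply A l⟩
  · let e : (I →₀ ℕ) →₀ A := ∑ β ∈ s, Finsupp.single β (c β)
    have heval : ∀ β, e β = if β ∈ s then c β else 0 := fun β => by
      simp [e, Finsupp.finsetSum_apply, Finsupp.single_apply]
    have he : e = 0 := by
      refine dpow_independent hbich hcomm hDgr hsimple hdhom hdcc hDd hred hdind ?_ ?_
      · intro β hβ
        rw [Finsupp.mem_support_iff, heval] at hβ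
        exact hs β (by_contra fun h => hβ (if_neg h))
      · simp only [e, map_sum, Finsupp.linearCombination_single]
        exact hsum
    have h := heval α
    rw [he, if_pos hα, Finsupp.zero_apply] at h
    rw [← h, map_zero, zero_mul]
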